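/- Let e = γ_0, γ_1, … be any (finite or infinite) execution of Algo_U. There exists kb ≥ 0 such that in every configuration γ_j of e and for every vertex p, d_p ≤ kb (equivalently, for every ℓ > kb, the set of vertices with d-value ℓ is empty in every γ_j). -/

import Mathlib

open SimpleGraph

/-- A configuration: a distance value `d` and a parent pointer `par` per vertex. -/
structure Config (V : Type*) where
  d : V → ℕ
  par : V → V

/-- `Min_d(p)`: the minimum of the `d`-values of the neighbors of `p`. -/
noncomputable def minD {V : Type*} (G : SimpleGraph V) (γ : Config V) (p : V) : ℕ :=
  sInf (γ.d '' {q | G.Adj p q})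

def dOk {V : Type*} (G : SimpleGraph V) (γ : Config V) (p : V) : Prop :=
  γ.d p = minD G γ p + 1

def parOk {V : Type*} (γ : Config V) (p : V) : Prop :=
  γ.d p = γ.d (γ.par p) + 1

/-- A valid configuration of `Algo_U`: `d r = 0` and parent pointers are neighbors. -/
def ValidU {V : Type*} (G : SimpleGraph V) (r : V) (γ : Config V) : Prop :=
  γ.d r = 0 ∧ ∀ p, p ≠ r → G.Adj p (γ.par p)

/-- A valid configuration of the bounded algorithms: non-root `d`-values in `{1,…,D}`. -/
def ValidB {V : Type*} (G : SimpleGraph V) (r : V) (D : ℕ) (γ : Config V) : Prop :=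
  γ.d r = 0 ∧ ∀ p, p ≠ r → G.Adj p (γ.par p) ∧ 1 ≤ γ.d p ∧ γ.d p ≤ D

/-- Vertex `p` executes rule `U1` or `U2` in the step from `γ` to `γ'`:
`U1 : ¬dOk(p) → update(p)`, `U2 : dOk(p) ∧ ¬parOk(p) → par_p ← bestParent(p)`. -/
def execU {V : Type*} (G : SimpleGraph V) (γ γ' : Config V) (p : V) : Prop :=
  (¬ dOk G γ p ∧ γ'.d p = minD G γ p + 1 ∧
    G.Adj p (γ'.par p) ∧ γ.d (γ'.par p) = minD G γ p) ∨
  (dOk G γ p ∧ ¬ parOk γ p ∧ γ'.d p = γ.d p ∧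
    G.Adj p (γ'.par p) ∧ γ.d (γ'.par p) = minD G γ p)

/-- Vertex `p` executes one of the rules `B1`, `B2`, `B3` of `Algo_B(D)`. -/
def execB {V : Type*} (G : SimpleGraph V) (D : ℕ) (γ γ' : Config V) (p : V) : Prop :=
  (minD G γ p < D ∧ ¬ dOk G γ p ∧ γ'.d p = minD G γ p + 1 ∧
    G.Adj p (γ'.par p) ∧ γ.d (γ'.par p) = minD G γ p) ∨
  (minD G γ p < D ∧ dOk G γ p ∧ ¬ parOk γ p ∧ γ'.d p = γ.d p ∧
    G.Adj p (γ'.par p) ∧ γ.d (γ'.par p) = minD G γ p) ∨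
  (minD G γ p = D ∧ γ.d p ≠ D ∧ γ'.d p = D ∧ γ'.par p = γ.par p)

/-- Vertex `p` executes rule `HC1` or `HC2` of `Algo_HC(D)`. -/
def execHC {V : Type*} (G : SimpleGraph V) (D : ℕ) (γ γ' : Config V) (p : V) : Prop :=
  (¬ parOk γ p ∧ γ.d (γ.par p) < D ∧ γ'.d p = γ.d (γ.par p) + 1 ∧ γ'.par p = γ.par p) ∨
  (minD G γ p < γ.d (γ.par p) ∧ γ'.d p = minD G γ p + 1 ∧
    G.Adj p (γ'.par p) ∧ γ.d (γ'.par p) = minD G γ p)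

/-- Vertex `p` executes rule `HC2`: `d_{par_p} > Min_d(p) → update(p)`. -/
def execHC2 {V : Type*} (G : SimpleGraph V) (γ γ' : Config V) (p : V) : Prop :=
  minD G γ p < γ.d (γ.par p) ∧ γ'.d p = minD G γ p + 1 ∧
    G.Adj p (γ'.par p) ∧ γ.d (γ'.par p) = minD G γ p

/-- Vertex `p` executes rule `FHC1` or `HC2` of `Algo_FHC(D)`. -/
def execFHC {V : Type*} (G : SimpleGraph V) (D : ℕ) (γ γ' : Config V) (p : V) : Prop :=
  (¬ parOk γ p ∧ γ.d (γ.par p) < D ∧ γ.d (γ.par p) = minD G γ p ∧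
    γ'.d p = γ.d (γ.par p) + 1 ∧ γ'.par p = γ.par p) ∨
  execHC2 G γ γ' p

/-- A step of a distributed unfair daemon: a nonempty set `S` of (non-root) vertices,
each executing one of its enabled rules (as described by `exec`), all other vertices
keeping their state. -/
def StepWith {V : Type*} (r : V) (exec : Config V → Config V → V → Prop)
    (γ γ' : Config V) (S : Set V) : Prop :=
  S.Nonempty ∧ (∀ p ∈ S, p ≠ r ∧ exec γ γ' p) ∧
    ∀ p ∉ S, γ'.d p = γ.d p ∧ γ'.par p = γ.par p

def Step {V : Type*} (r : V) (exec : Config V → Config V → V → Prop)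
    (γ γ' : Config V) : Prop :=
  ∃ S : Set V, StepWith r exec γ γ' S

/-- Guard of the rules of `Algo_U` at `p`. -/
def guardU {V : Type*} (G : SimpleGraph V) (γ : Config V) (p : V) : Prop :=
  ¬ dOk G γ p ∨ (dOk G γ p ∧ ¬ parOk γ p)

/-- Guard of the rules of `Algo_B(D)` at `p`. -/
def guardB {V : Type*} (G : SimpleGraph V) (D : ℕ) (γ : Config V) (p : V) : Prop :=
  (minD G γ p < D ∧ ¬ dOk G γ p) ∨
  (minD G γ p < D ∧ dOk G γ p ∧ ¬ parOk γ p) ∨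
  (minD G γ p = D ∧ γ.d p ≠ D)

/-- Guard of the rules of `Algo_HC(D)` at `p`. -/
def guardHC {V : Type*} (G : SimpleGraph V) (D : ℕ) (γ : Config V) (p : V) : Prop :=
  (¬ parOk γ p ∧ γ.d (γ.par p) < D) ∨ minD G γ p < γ.d (γ.par p)

/-- Guard of the rules of `Algo_FHC(D)` at `p`. -/
def guardFHC {V : Type*} (G : SimpleGraph V) (D : ℕ) (γ : Config V) (p : V) : Prop :=
  (¬ parOk γ p ∧ γ.d (γ.par p) < D ∧ γ.d (γ.par p) = minD G γ p) ∨
  minD G γ p < γ.d (γ.par p)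

/-- A vertex is enabled when it is not the root and one of its guards holds. -/
def Enabled {V : Type*} (r : V) (guard : Config V → V → Prop) (γ : Config V) (p : V) : Prop :=
  p ≠ r ∧ guard γ p

/-- A terminal configuration: no vertex is enabled. -/
def Terminal {V : Type*} (r : V) (guard : Config V → V → Prop) (γ : Config V) : Prop :=
  ∀ p, ¬ Enabled r guard γ p

/-- An execution (padded by stuttering once a terminal configuration is reached, so
that maximality is automatic): `e i` is the `i`-th configuration and `M i` the set of
vertices selected by the daemon at step `i`. -/
def IsExec {V : Type*} (r : V) (valid : Config V → Prop)
    (exec : Config V → Config V → V → Prop) (guard : Config V → V → Prop)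
    (e : ℕ → Config V) (M : ℕ → Set V) : Prop :=
  (∀ i, valid (e i)) ∧
    ∀ i, (Terminal r guard (e i) ∧ e (i + 1) = e i ∧ M i = ∅) ∨
      StepWith r exec (e i) (e (i + 1)) (M i)

/-- Every vertex enabled in `e s` executes a rule or becomes neutralized in some step
`j` with `s ≤ j < t`. -/
def Covers {V : Type*} (r : V) (guard : Config V → V → Prop)
    (e : ℕ → Config V) (M : ℕ → Set V) (s t : ℕ) : Prop :=
  ∀ p, Enabled r guard (e s) p →
    ∃ j, s ≤ j ∧ j < t ∧
      (p ∈ M j ∨ (Enabled r guard (e j) p ∧ ¬ Enabled r guard (e (j + 1)) p))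

/-- `t` is the end of the round of execution `(e, M)` starting at index `s`:
the prefix from `s` to `t` is the minimal one in which every vertex enabled at `e s`
executes a rule or is neutralized. -/
def RoundEnd {V : Type*} (r : V) (guard : Config V → V → Prop)
    (e : ℕ → Config V) (M : ℕ → Set V) (s t : ℕ) : Prop :=
  s ≤ t ∧ Covers r guard e M s t ∧ ∀ u, s ≤ u → Covers r guard e M s u → t ≤ u

theorem minD_le_of_adj {V : Type*} {G : SimpleGraph V} (γ : Config V) {p q : V}
    (h : G.Adj p q) : minD G γ p ≤ γ.d q :=
  Nat.sInf_le ⟨q, h, rfl⟩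

/-- A step of `Algo_U` leaves `d p` unchanged or makes it at most one more than the value of
any given neighbor. -/
theorem Step.d_eq_or_le_of_adj {V : Type*} {G : SimpleGraph V} {r : V} {γ γ' : Config V}
    (hs : Step r (execU G) γ γ') {p q : V} (h : G.Adj p q) :
    γ'.d p = γ.d p ∨ γ'.d p ≤ γ.d q + 1 := by
  obtain ⟨S, -, hS, hS'⟩ := hs
  by_cases hp : p ∈ S
  · rcases (hS p hp).2 with ⟨-, hd, -⟩ | ⟨-, -, hd, -⟩
    · exact Or.inr (hd ▸ Nat.succ_le_succ (minD_le_of_adj γ h))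
    · exact Or.inl hd
  · exact Or.inl (hS' p hp).1

/-- If the initial `d`-values are at most `K`, then `d p` never exceeds `K` plus the length of
any walk from `p` to the root. -/
theorem d_le_add_walk_length {V : Type*} {G : SimpleGraph V} {r : V} {e : ℕ → Config V}
    (hvalid : ∀ i, ValidU G r (e i))
    (hstep : ∀ i, Step r (execU G) (e i) (e (i + 1)) ∨ e (i + 1) = e i)
    {K : ℕ} (hK : ∀ p, (e 0).d p ≤ K) {p : V} (w : G.Walk p r) (j : ℕ) :
    (e j).d p ≤ K + w.length := by
  induction w generalizing j with
  | nil => simp [(hvalid j).1]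
  | cons h w ih =>
    rw [Walk.length_cons]
    specialize ih hvalid hstep
    induction j with
    | zero => exact (hK _).trans (Nat.le_add_right _ _)
    | succ j ihj =>
      rcases hstep j with hs | hs
      · have := ih j
        rcases hs.d_eq_or_le_of_adj h with hd | hd <;> omega
      · rwa [hs]

/-- Let `e = γ_0, γ_1, …` be any (finite or infinite) execution of `Algo_U`, modeled as
an infinite sequence in which each step is either a genuine step or stutters at a
terminal configuration. There exists `kb ≥ 0` bounding all `d`-values in all
configurations of `e`. -/
theorem algoU_d_values_bounded {V : Type*} [Fintype V]
    (G : SimpleGraph V) (hconn : G.Connected) (r : V) (e : ℕ → Config V)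
    (hvalid : ∀ i, ValidU G r (e i))
    (hstep : ∀ i, Step r (execU G) (e i) (e (i + 1)) ∨
      (Terminal r (guardU G) (e i) ∧ e (i + 1) = e i)) :
    ∃ kb : ℕ, ∀ j p, (e j).d p ≤ kb := by
  obtain ⟨K, hK⟩ := (Set.finite_range (e 0).d).bddAbove
  let w (p : V) : G.Walk p r := (hconn.preconnected p r).some
  obtain ⟨L, hL⟩ := (Set.finite_range fun p => (w p).length).bddAbove
  refine ⟨K + L, fun j p => ?_⟩
  have hw := d_le_add_walk_length hvalid (fun i => (hstep i).imp_right And.right)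
    (fun q => hK ⟨q, rfl⟩) (w p) j
  exact hw.trans (Nat.add_le_add_left (hL ⟨p, rfl⟩) K)
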